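/- Let σ1, σ2 > 0, ρ ∈ (−1,1), α1 ∈ (−1,0) and α2 ∈ (0,2]. Then E[|X1|^{α1}|X2|^{α2}] − E[|X1|^{α1}]·E[|X2|^{α2}] ≤ (2^{(α1+α2)/2} α1 α2 σ1^{α1} σ2^{α2} ρ² / (2π)) · Γ((α1+1)/2) · Γ((α2+1)/2) ≤ 0. -/

import Mathlib

open MeasureTheory Real

/-- Centered bivariate Gaussian density with variances σ₁², σ₂² and correlation ρ. -/
noncomputable def gaussDensity2 (σ₁ σ₂ ρ x y : ℝ) : ℝ :=
  (2 * π * σ₁ * σ₂ * Real.sqrt (1 - ρ ^ 2))⁻¹ *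
    Real.exp (-(x ^ 2 / σ₁ ^ 2 - 2 * ρ * x * y / (σ₁ * σ₂) + y ^ 2 / σ₂ ^ 2) /
      (2 * (1 - ρ ^ 2)))

/-- E[|X₁|^a |X₂|^b] for the centered bivariate Gaussian. -/
noncomputable def E2 (σ₁ σ₂ ρ a b : ℝ) : ℝ :=
  ∫ q : ℝ × ℝ, |q.1| ^ a * |q.2| ^ b * gaussDensity2 σ₁ σ₂ ρ q.1 q.2

/-- E[|X|^a] for a centered Gaussian with variance σ². -/
noncomputable def E1 (σ a : ℝ) : ℝ :=
  ∫ x : ℝ, |x| ^ a * (Real.sqrt (2 * π * σ ^ 2))⁻¹ * Real.exp (-x ^ 2 / (2 * σ ^ 2))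

theorem integral_abs_rpow_mul_exp_neg_mul_sq {r c : ℝ} (hr : -1 < r) (hc : 0 < c) :
    ∫ x : ℝ, |x| ^ r * exp (-(c * x ^ 2)) = c ^ (-(r + 1) / 2) * Gamma ((r + 1) / 2) := by
  have h := integral_comp_abs (f := fun x : ℝ => x ^ r * exp (-c * x ^ (2 : ℝ)))
  rw [integral_rpow_mul_exp_neg_mul_rpow two_pos hr hc] at h
  simp only [rpow_two, sq_abs, neg_mul] at h
  rw [h]
  ring

theorem integrable_abs_rpow_mul_exp_neg_mul_sq {r c : ℝ} (hr : -1 < r) (hc : 0 < c) :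
    Integrable fun x : ℝ => |x| ^ r * exp (-(c * x ^ 2)) := by
  apply Integrable.of_integral_ne_zero
  rw [integral_abs_rpow_mul_exp_neg_mul_sq hr hc]
  have := Gamma_pos_of_pos (show 0 < (r + 1) / 2 by linarith)
  positivity

theorem one_add_mul_le_rpow_of_nonpos {s p : ℝ} (hs : -1 < s) (hp : p ≤ 0) :
    1 + p * s ≤ (1 + s) ^ p := by
  have hs' : 0 < 1 + s := by linarith
  rw [rpow_def_of_pos hs']
  have h₁ := add_one_le_exp (log (1 + s) * p)
  have h₂ := log_le_sub_one_of_pos hs'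
  nlinarith

theorem integrableOn_rpow_mul_one_sub_exp_neg {q : ℝ} (hq₀ : 0 < q) (hq₁ : q < 1) :
    IntegrableOn (fun s : ℝ => s ^ (-1 - q) * (1 - exp (-s))) (Set.Ioi 0) := by
  have hm : Measurable fun s : ℝ => s ^ (-1 - q) * (1 - exp (-s)) := by fun_prop
  rw [← Set.Ioc_union_Ioi_eq_Ioi (zero_le_one' ℝ)]
  refine IntegrableOn.union ?_ ?_
  · have h : IntegrableOn (fun s : ℝ => s ^ (-q)) (Set.Ioc 0 1) := by
      rw [← intervalIntegrable_iff_integrableOn_Ioc_of_le zero_le_one]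
      exact intervalIntegral.intervalIntegrable_rpow' (by linarith)
    refine h.mono' hm.aestronglyMeasurable (ae_restrict_of_forall_mem measurableSet_Ioc ?_)
    rintro s ⟨hs, -⟩
    have h₁ : 0 ≤ 1 - exp (-s) := by simpa using hs.le
    have h₂ := add_one_le_exp (-s)
    rw [norm_of_nonneg (by positivity), show -q = (-1 - q) + 1 by ring, rpow_add hs, rpow_one]
    gcongr
    linarith
  · refine (integrableOn_Ioi_rpow_of_lt (show -1 - q < -1 by linarith) zero_lt_one).mono'
      hm.aestronglyMeasurable (ae_restrict_of_forall_mem measurableSet_Ioi ?_)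
    intro s hs
    have hs : 0 < s := zero_lt_one.trans hs
    have h₁ : 0 ≤ 1 - exp (-s) := by simpa using hs.le
    rw [norm_of_nonneg (by positivity)]
    exact mul_le_of_le_one_right (by positivity) (by linarith [exp_pos (-s)])

theorem integral_rpow_mul_one_sub_exp_neg_pos {q : ℝ} (hq₀ : 0 < q) (hq₁ : q < 1) :
    0 < ∫ s in Set.Ioi (0 : ℝ), s ^ (-1 - q) * (1 - exp (-s)) := by
  have hpos : ∀ s ∈ Set.Ioi (0 : ℝ), 0 < s ^ (-1 - q) * (1 - exp (-s)) := fun s hs =>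
    mul_pos (rpow_pos_of_pos hs _) (by simpa using hs)
  rw [setIntegral_pos_iff_support_of_nonneg_ae
    (ae_restrict_of_forall_mem measurableSet_Ioi fun s hs => (hpos s hs).le)
    (integrableOn_rpow_mul_one_sub_exp_neg hq₀ hq₁)]
  have hsub : Set.Ioi (0 : ℝ) ⊆ Function.support fun s : ℝ => s ^ (-1 - q) * (1 - exp (-s)) :=
    fun s hs => (hpos s hs).ne'
  rw [Set.inter_eq_right.2 hsub]
  simp

theorem rpow_mul_one_sub_exp_neg_mul {q s z : ℝ} (hs : 0 < s) (hz : 0 < z) :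
    s ^ (-1 - q) * (1 - exp (-(s * z))) =
      z ^ (1 + q) * ((z * s) ^ (-1 - q) * (1 - exp (-(z * s)))) := by
  rw [mul_rpow hz.le hs.le, ← mul_assoc, ← mul_assoc, ← rpow_add hz, mul_comm z s]
  simp

theorem integrableOn_rpow_mul_one_sub_exp_neg_mul {q z : ℝ} (hq₀ : 0 < q) (hq₁ : q < 1)
    (hz : 0 ≤ z) :
    IntegrableOn (fun s : ℝ => s ^ (-1 - q) * (1 - exp (-(s * z)))) (Set.Ioi 0) := by
  rcases hz.eq_or_lt with rfl | hz
  · simp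
  · have h := (integrableOn_Ioi_comp_mul_left_iff
      (fun s : ℝ => s ^ (-1 - q) * (1 - exp (-s))) 0 hz).2
      (by simpa using integrableOn_rpow_mul_one_sub_exp_neg hq₀ hq₁)
    exact IntegrableOn.congr_fun (h.const_mul (z ^ (1 + q)))
      (fun s hs => (rpow_mul_one_sub_exp_neg_mul hs hz).symm) measurableSet_Ioi

theorem integral_rpow_mul_one_sub_exp_neg_mul {q z : ℝ} (hq : 0 < q) (hz : 0 ≤ z) :
    ∫ s in Set.Ioi (0 : ℝ), s ^ (-1 - q) * (1 - exp (-(s * z))) =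
      z ^ q * ∫ s in Set.Ioi (0 : ℝ), s ^ (-1 - q) * (1 - exp (-s)) := by
  rcases hz.eq_or_lt with rfl | hz
  · simp [zero_rpow hq.ne']
  · rw [setIntegral_congr_fun measurableSet_Ioi
      fun s hs => rpow_mul_one_sub_exp_neg_mul (q := q) hs hz, integral_const_mul,
      integral_comp_mul_left_Ioi (fun s : ℝ => s ^ (-1 - q) * (1 - exp (-s))) 0 hz, mul_zero,
      smul_eq_mul, ← mul_assoc, ← rpow_neg_one z, ← rpow_add hz]
    simp

section Comparison

variable {α β : Type*} [MeasurableSpace α] [MeasurableSpace β]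

theorem integrable_prod_rpow_mul_one_sub_exp_neg_mul {μ : Measure α} [SFinite μ] {Z w : α → ℝ}
    {q : ℝ} (hq₀ : 0 < q) (hq₁ : q < 1) (hZ : Measurable Z) (hZ₀ : ∀ x, 0 ≤ Z x)
    (hw : Measurable w) (hZw : Integrable (fun x => Z x ^ q * w x) μ) :
    Integrable (fun p : α × ℝ => p.2 ^ (-1 - q) * (1 - exp (-(p.2 * Z p.1))) * w p.1)
      (μ.prod (volume.restrict (Set.Ioi 0))) := by
  rw [integrable_prod_iff (Measurable.aestronglyMeasurable (by fun_prop))]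
  constructor
  · filter_upwards with x
    exact (integrableOn_rpow_mul_one_sub_exp_neg_mul hq₀ hq₁ (hZ₀ x)).mul_const (w x)
  · refine (hZw.norm.mul_const (∫ s in Set.Ioi (0 : ℝ), s ^ (-1 - q) * (1 - exp (-s)))).congr ?_
    filter_upwards with x
    rw [norm_mul, norm_of_nonneg (rpow_nonneg (hZ₀ x) q), mul_right_comm,
      ← integral_rpow_mul_one_sub_exp_neg_mul hq₀ (hZ₀ x), ← integral_mul_const]
    refine setIntegral_congr_fun measurableSet_Ioi fun s hs => ?_
    have h : 0 ≤ 1 - exp (-(s * Z x)) := by simpa using mul_nonneg (le_of_lt hs) (hZ₀ x)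
    have hs' : 0 ≤ s ^ (-1 - q) := rpow_nonneg (le_of_lt hs) _
    simp only [norm_mul, norm_of_nonneg h, norm_of_nonneg hs']

theorem integral_rpow_mul_integral_one_sub_exp_neg_mul {μ : Measure α} [SFinite μ] {Z w : α → ℝ}
    {q : ℝ} (hq₀ : 0 < q) (hq₁ : q < 1) (hZ : Measurable Z) (hZ₀ : ∀ x, 0 ≤ Z x)
    (hw : Measurable w) (hZw : Integrable (fun x => Z x ^ q * w x) μ) :
    ∫ s in Set.Ioi (0 : ℝ), s ^ (-1 - q) * ∫ x, (1 - exp (-(s * Z x))) * w x ∂μ =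
      (∫ x, Z x ^ q * w x ∂μ) * ∫ s in Set.Ioi (0 : ℝ), s ^ (-1 - q) * (1 - exp (-s)) := by
  have h := integral_integral_swap
    (f := fun x s => s ^ (-1 - q) * (1 - exp (-(s * Z x))) * w x)
    (integrable_prod_rpow_mul_one_sub_exp_neg_mul hq₀ hq₁ hZ hZ₀ hw hZw)
  simp only [mul_assoc, integral_const_mul] at h
  rw [← h, ← integral_mul_const]
  refine integral_congr_ae (.of_forall fun x => ?_)
  simp only [← mul_assoc]
  rw [integral_mul_const, integral_rpow_mul_one_sub_exp_neg_mul hq₀ (hZ₀ x)]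
  ring

theorem integrableOn_rpow_mul_integral_one_sub_exp_neg_mul {μ : Measure α} [SFinite μ]
    {Z w : α → ℝ} {q : ℝ} (hq₀ : 0 < q) (hq₁ : q < 1) (hZ : Measurable Z) (hZ₀ : ∀ x, 0 ≤ Z x)
    (hw : Measurable w) (hZw : Integrable (fun x => Z x ^ q * w x) μ) :
    IntegrableOn (fun s : ℝ => s ^ (-1 - q) * ∫ x, (1 - exp (-(s * Z x))) * w x ∂μ)
      (Set.Ioi 0) := by
  have h := (integrable_prod_rpow_mul_one_sub_exp_neg_mul hq₀ hq₁ hZ hZ₀ hw hZw).integral_prod_right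
  simpa only [IntegrableOn, mul_assoc, integral_const_mul] using h

theorem tendsto_natCast_mul_integral_one_sub_exp_neg {μ : Measure α} {Z w : α → ℝ}
    (hZ : Measurable Z) (hZ₀ : ∀ x, 0 ≤ Z x) (hw : Measurable w)
    (hZw : Integrable (fun x => Z x * w x) μ) :
    Filter.Tendsto (fun n : ℕ => (n : ℝ) * ∫ x, (1 - exp (-((n : ℝ)⁻¹ * Z x))) * w x ∂μ)
      Filter.atTop (nhds (∫ x, Z x * w x ∂μ)) := by
  simp only [← integral_const_mul]
  refine tendsto_integral_of_dominated_convergence (fun x => ‖Z x * w x‖)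
    (fun n => Measurable.aestronglyMeasurable (by fun_prop)) hZw.norm
    (fun n => .of_forall fun x => ?_) (.of_forall fun x => ?_)
  · rw [← mul_assoc, norm_mul _ (w x), norm_mul _ (w x)]
    refine mul_le_mul_of_nonneg_right ?_ (norm_nonneg _)
    have h₁ : 0 ≤ 1 - exp (-((n : ℝ)⁻¹ * Z x)) := by
      have := hZ₀ x
      simp only [sub_nonneg, exp_le_one_iff, Left.neg_nonpos_iff]
      positivity
    have h₂ := add_one_le_exp (-((n : ℝ)⁻¹ * Z x))
    rw [norm_of_nonneg (by positivity), norm_of_nonneg (hZ₀ x)]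
    rcases n.eq_zero_or_pos with rfl | hn
    · simpa using hZ₀ x
    · have hn : (0 : ℝ) < n := by exact_mod_cast hn
      calc (n : ℝ) * (1 - exp (-((n : ℝ)⁻¹ * Z x))) ≤ n * ((n : ℝ)⁻¹ * Z x) := by
            gcongr
            linarith
        _ = Z x := by field_simp
  · simp only [← mul_assoc]
    refine Filter.Tendsto.mul_const _ ?_
    have hd : HasDerivAt (fun t : ℝ => 1 - exp (-(t * Z x))) (Z x) 0 := by
      have := (((hasDerivAt_id (0 : ℝ)).mul_const (Z x)).neg.exp).const_sub 1
      simpa using this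
    have h := hd.tendsto_slope_zero_right.comp
      (tendsto_inv_atTop_nhdsGT_zero.comp tendsto_natCast_atTop_atTop)
    simpa [Function.comp_def] using h

/-- An inequality between Laplace-type functionals passes to the moments of order at most one. -/
theorem integral_rpow_mul_le_of_integral_one_sub_exp_le {μ : Measure α} {ν : Measure β}
    [SFinite μ] [SFinite ν] {Z w : α → ℝ} {Z' w' : β → ℝ} {q : ℝ} (hq₀ : 0 < q) (hq₁ : q ≤ 1)
    (hZ : Measurable Z) (hZ₀ : ∀ x, 0 ≤ Z x) (hw : Measurable w)
    (hZw : Integrable (fun x => Z x ^ q * w x) μ)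
    (hZ' : Measurable Z') (hZ₀' : ∀ y, 0 ≤ Z' y) (hw' : Measurable w')
    (hZw' : Integrable (fun y => Z' y ^ q * w' y) ν)
    (h : ∀ s > 0, ∫ x, (1 - exp (-(s * Z x))) * w x ∂μ ≤
      ∫ y, (1 - exp (-(s * Z' y))) * w' y ∂ν) :
    ∫ x, Z x ^ q * w x ∂μ ≤ ∫ y, Z' y ^ q * w' y ∂ν := by
  rcases hq₁.eq_or_lt with rfl | hq₁
  · simp only [rpow_one] at *
    refine le_of_tendsto_of_tendsto (tendsto_natCast_mul_integral_one_sub_exp_neg hZ hZ₀ hw hZw)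
      (tendsto_natCast_mul_integral_one_sub_exp_neg hZ' hZ₀' hw' hZw') ?_
    filter_upwards [Filter.eventually_gt_atTop 0] with n hn
    gcongr
    exact h _ (by positivity)
  · refine le_of_mul_le_mul_right ?_ (integral_rpow_mul_one_sub_exp_neg_pos hq₀ hq₁)
    rw [← integral_rpow_mul_integral_one_sub_exp_neg_mul hq₀ hq₁ hZ hZ₀ hw hZw,
      ← integral_rpow_mul_integral_one_sub_exp_neg_mul hq₀ hq₁ hZ' hZ₀' hw' hZw']
    refine setIntegral_mono_on
      (integrableOn_rpow_mul_integral_one_sub_exp_neg_mul hq₀ hq₁ hZ hZ₀ hw hZw)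
      (integrableOn_rpow_mul_integral_one_sub_exp_neg_mul hq₀ hq₁ hZ' hZ₀' hw' hZw')
      measurableSet_Ioi fun s hs => ?_
    have hs : 0 < s := hs
    gcongr
    exact h s hs

end Comparison

theorem gaussDensity2_le {σ₁ σ₂ ρ : ℝ} (hσ₁ : 0 < σ₁) (hσ₂ : 0 < σ₂) (hρ : ρ ^ 2 < 1) (x y : ℝ) :
    gaussDensity2 σ₁ σ₂ ρ x y ≤ (2 * π * σ₁ * σ₂ * √(1 - ρ ^ 2))⁻¹ *
      (exp (-(1 / (4 * σ₁ ^ 2) * x ^ 2)) * exp (-(1 / (4 * σ₂ ^ 2) * y ^ 2))) := by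
  have hτ : 0 < 1 - ρ ^ 2 := by linarith
  rw [gaussDensity2, ← exp_add]
  gcongr
  rw [div_le_iff₀ (by positivity)]
  have h : 0 ≤ ((x / σ₁ - ρ * (y / σ₂)) ^ 2 + (ρ * (x / σ₁) - y / σ₂) ^ 2) / 2 := by positivity
  have e : (-(1 / (4 * σ₁ ^ 2) * x ^ 2) + -(1 / (4 * σ₂ ^ 2) * y ^ 2)) * (2 * (1 - ρ ^ 2)) -
      -(x ^ 2 / σ₁ ^ 2 - 2 * ρ * x * y / (σ₁ * σ₂) + y ^ 2 / σ₂ ^ 2) =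
      ((x / σ₁ - ρ * (y / σ₂)) ^ 2 + (ρ * (x / σ₁) - y / σ₂) ^ 2) / 2 := by
    field_simp
    ring
  linarith

theorem gaussDensity2_nonneg {σ₁ σ₂ : ℝ} (hσ₁ : 0 < σ₁) (hσ₂ : 0 < σ₂) (ρ x y : ℝ) :
    0 ≤ gaussDensity2 σ₁ σ₂ ρ x y := by
  unfold gaussDensity2
  positivity

theorem measurable_gaussDensity2 (σ₁ σ₂ ρ : ℝ) :
    Measurable fun q : ℝ × ℝ => gaussDensity2 σ₁ σ₂ ρ q.1 q.2 := by
  unfold gaussDensity2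
  fun_prop

theorem integrable_abs_rpow_mul_abs_rpow_mul_gaussDensity2 {σ₁ σ₂ ρ a b : ℝ} (hσ₁ : 0 < σ₁)
    (hσ₂ : 0 < σ₂) (hρ : ρ ^ 2 < 1) (ha : -1 < a) (hb : -1 < b) :
    Integrable fun q : ℝ × ℝ => |q.1| ^ a * |q.2| ^ b * gaussDensity2 σ₁ σ₂ ρ q.1 q.2 := by
  have hm := measurable_gaussDensity2 σ₁ σ₂ ρ
  have h := ((integrable_abs_rpow_mul_exp_neg_mul_sq ha
    (show 0 < 1 / (4 * σ₁ ^ 2) by positivity)).mul_prod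
    (integrable_abs_rpow_mul_exp_neg_mul_sq hb
      (show 0 < 1 / (4 * σ₂ ^ 2) by positivity))).const_mul
    (2 * π * σ₁ * σ₂ * √(1 - ρ ^ 2))⁻¹
  refine Integrable.mono' h (Measurable.aestronglyMeasurable (by fun_prop))
    (.of_forall fun q => ?_)
  have h₀ := gaussDensity2_nonneg hσ₁ hσ₂ ρ q.1 q.2
  rw [norm_of_nonneg (by positivity)]
  calc |q.1| ^ a * |q.2| ^ b * gaussDensity2 σ₁ σ₂ ρ q.1 q.2
    _ ≤ |q.1| ^ a * |q.2| ^ b * ((2 * π * σ₁ * σ₂ * √(1 - ρ ^ 2))⁻¹ *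
          (exp (-(1 / (4 * σ₁ ^ 2) * q.1 ^ 2)) * exp (-(1 / (4 * σ₂ ^ 2) * q.2 ^ 2)))) := by
        gcongr
        exact gaussDensity2_le hσ₁ hσ₂ hρ q.1 q.2
    _ = _ := by ring

theorem integrable_exp_neg_mul_sq_mul_abs_rpow_mul_gaussDensity2 {σ₁ σ₂ ρ a s : ℝ}
    (hσ₁ : 0 < σ₁) (hσ₂ : 0 < σ₂) (hρ : ρ ^ 2 < 1) (ha : -1 < a) (hs : 0 ≤ s) :
    Integrable fun q : ℝ × ℝ =>
      exp (-(s * q.2 ^ 2)) * (|q.1| ^ a * gaussDensity2 σ₁ σ₂ ρ q.1 q.2) := by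
  have h := integrable_abs_rpow_mul_abs_rpow_mul_gaussDensity2 hσ₁ hσ₂ hρ ha neg_one_lt_zero
  simp only [rpow_zero, mul_one] at h
  refine h.bdd_mul (c := 1) (Measurable.aestronglyMeasurable (by fun_prop))
    (.of_forall fun q => ?_)
  rw [norm_of_nonneg (exp_pos _).le, exp_le_one_iff]
  have : 0 ≤ s * q.2 ^ 2 := by positivity
  linarith

theorem E1_eq {σ a : ℝ} (hσ : 0 < σ) (ha : -1 < a) :
    E1 σ a = (√π)⁻¹ * (2 * σ ^ 2) ^ (a / 2) * Gamma ((a + 1) / 2) := by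
  have h := integral_abs_rpow_mul_exp_neg_mul_sq ha (show 0 < (2 * σ ^ 2)⁻¹ by positivity)
  have e : E1 σ a = (√(2 * π * σ ^ 2))⁻¹ * ∫ x : ℝ, |x| ^ a * exp (-((2 * σ ^ 2)⁻¹ * x ^ 2)) := by
    rw [E1, ← integral_const_mul]
    congr 1 with x
    rw [show -x ^ 2 / (2 * σ ^ 2) = -((2 * σ ^ 2)⁻¹ * x ^ 2) by ring]
    ring
  have hV : 0 < 2 * σ ^ 2 := by positivity
  rw [e, h, inv_rpow hV.le, ← rpow_neg hV.le, show -(-(a + 1) / 2) = a / 2 + 1 / 2 by ring,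
    rpow_add hV, ← sqrt_eq_rpow, show 2 * π * σ ^ 2 = π * (2 * σ ^ 2) by ring,
    sqrt_mul pi_pos.le]
  have := sqrt_pos.2 hV
  field_simp

theorem integral_exp_neg_mul_sq_mul_gaussDensity2 {σ₁ σ₂ ρ s : ℝ} (hσ₁ : 0 < σ₁) (hσ₂ : 0 < σ₂)
    (hρ : ρ ^ 2 < 1) (hs : 0 ≤ s) (x : ℝ) :
    ∫ y, exp (-(s * y ^ 2)) * gaussDensity2 σ₁ σ₂ ρ x y =
      (2 * π * σ₁ * σ₂ * √(1 - ρ ^ 2))⁻¹ *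
        √(π / ((1 + 2 * s * σ₂ ^ 2 * (1 - ρ ^ 2)) / (2 * σ₂ ^ 2 * (1 - ρ ^ 2)))) *
        exp (-((1 + 2 * s * σ₂ ^ 2) / (2 * σ₁ ^ 2 * (1 + 2 * s * σ₂ ^ 2 * (1 - ρ ^ 2))) *
          x ^ 2)) := by
  have hτ : 0 < 1 - ρ ^ 2 := by linarith
  have hP : 0 < 1 + 2 * s * σ₂ ^ 2 * (1 - ρ ^ 2) := by positivity
  set D := (1 + 2 * s * σ₂ ^ 2 * (1 - ρ ^ 2)) / (2 * σ₂ ^ 2 * (1 - ρ ^ 2)) with hD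
  set E := (1 + 2 * s * σ₂ ^ 2) / (2 * σ₁ ^ 2 * (1 + 2 * s * σ₂ ^ 2 * (1 - ρ ^ 2))) with hE
  set t := ρ * σ₂ / (σ₁ * (1 + 2 * s * σ₂ ^ 2 * (1 - ρ ^ 2))) * x with ht
  have hpt : ∀ y, exp (-(s * y ^ 2)) * gaussDensity2 σ₁ σ₂ ρ x y =
      (2 * π * σ₁ * σ₂ * √(1 - ρ ^ 2))⁻¹ * exp (-(E * x ^ 2)) * exp (-D * (y - t) ^ 2) := by
    intro y
    rw [gaussDensity2, mul_left_comm, ← exp_add, mul_assoc _ (exp _), ← exp_add]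
    congr 2
    rw [hD, hE, ht]
    field_simp
    ring
  simp only [hpt]
  rw [integral_const_mul, integral_sub_right_eq_self (fun y => exp (-D * y ^ 2)) t,
    integral_gaussian]
  ring

theorem integral_exp_neg_mul_sq_mul_abs_rpow_mul_gaussDensity2 {σ₁ σ₂ ρ a s : ℝ}
    (hσ₁ : 0 < σ₁) (hσ₂ : 0 < σ₂) (hρ : ρ ^ 2 < 1) (ha : -1 < a) (hs : 0 ≤ s) :
    ∫ q : ℝ × ℝ, exp (-(s * q.2 ^ 2)) * (|q.1| ^ a * gaussDensity2 σ₁ σ₂ ρ q.1 q.2) =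
      E1 σ₁ a * (√(1 + 2 * s * σ₂ ^ 2))⁻¹ *
        ((1 + 2 * s * σ₂ ^ 2 * (1 - ρ ^ 2)) / (1 + 2 * s * σ₂ ^ 2)) ^ (a / 2) := by
  have hτ : 0 < 1 - ρ ^ 2 := by linarith
  rw [Measure.volume_eq_prod, integral_prod _
    (integrable_exp_neg_mul_sq_mul_abs_rpow_mul_gaussDensity2 hσ₁ hσ₂ hρ ha hs)]
  simp only [mul_left_comm (exp _), integral_const_mul,
    integral_exp_neg_mul_sq_mul_gaussDensity2 hσ₁ hσ₂ hρ hs]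
  simp only [mul_left_comm (_ ^ a), integral_const_mul]
  rw [integral_abs_rpow_mul_exp_neg_mul_sq ha (by positivity), E1_eq hσ₁ ha]
  have hP : 0 < 1 + 2 * s * σ₂ ^ 2 * (1 - ρ ^ 2) := by positivity
  have hT : 0 < 1 + 2 * s * σ₂ ^ 2 := by positivity
  have hV : 0 < 2 * σ₁ ^ 2 := by positivity
  generalize 1 + 2 * s * σ₂ ^ 2 * (1 - ρ ^ 2) = P at *
  generalize 1 + 2 * s * σ₂ ^ 2 = T at *
  generalize 1 - ρ ^ 2 = τ at *
  have hsq : √(π / (P / (2 * σ₂ ^ 2 * τ))) = √π * (√2 * σ₂ * √τ) / √P := by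
    rw [show π / (P / (2 * σ₂ ^ 2 * τ)) = π * (2 * σ₂ ^ 2 * τ) / P by field_simp,
      sqrt_div (by positivity), sqrt_mul pi_pos.le, sqrt_mul (by positivity),
      sqrt_mul zero_le_two, sqrt_sq hσ₂.le]
  have hpw : (T / (2 * σ₁ ^ 2 * P)) ^ (-(a + 1) / 2) =
      (2 * σ₁ ^ 2) ^ (a / 2) * (√2 * σ₁) * (P / T) ^ (a / 2) * (√P / √T) := by
    rw [show T / (2 * σ₁ ^ 2 * P) = (2 * σ₁ ^ 2 * (P / T))⁻¹ by field_simp,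
      inv_rpow (by positivity), ← rpow_neg (by positivity),
      show -(-(a + 1) / 2) = a / 2 + 1 / 2 by ring, mul_rpow hV.le (by positivity),
      rpow_add hV, rpow_add (by positivity), ← sqrt_eq_rpow, ← sqrt_eq_rpow,
      sqrt_mul zero_le_two, sqrt_sq hσ₁.le, sqrt_div hP.le]
    ring
  rw [hsq, hpw]
  have h₁ := sqrt_pos.2 hP
  have h₂ := sqrt_pos.2 hT
  have h₃ := sqrt_pos.2 hτ
  have h₄ := sqrt_pos.2 pi_pos
  have h₅ : √π ^ 2 = π := sq_sqrt pi_pos.le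
  have h₆ : √2 ^ 2 = (2 : ℝ) := sq_sqrt zero_le_two
  field_simp
  rw [h₅, h₆]
  ring

theorem abs_rpow_mul_sq {r : ℝ} (hr : -1 < r) (y : ℝ) : |y| ^ r * y ^ 2 = |y| ^ (r + 2) := by
  rcases eq_or_ne y 0 with rfl | hy
  · simp [zero_rpow (show r + 2 ≠ 0 by linarith)]
  · rw [rpow_add (abs_pos.2 hy), rpow_two, sq_abs]

theorem integrable_abs_rpow_mul_quadratic_mul_exp {r c : ℝ} (hr : -1 < r) (hc : 0 < c)
    (σ k : ℝ) :
    Integrable fun y : ℝ => |y| ^ r * ((1 + k * (y ^ 2 / σ ^ 2 - 1)) * exp (-(c * y ^ 2))) := by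
  refine (((integrable_abs_rpow_mul_exp_neg_mul_sq hr hc).const_mul (1 - k)).add
    ((integrable_abs_rpow_mul_exp_neg_mul_sq (show -1 < r + 2 by linarith) hc).const_mul
      (k / σ ^ 2))).congr (.of_forall fun y => ?_)
  simp only [Pi.add_apply, ← abs_rpow_mul_sq hr]
  ring

theorem integral_abs_rpow_mul_quadratic_mul_exp {r c : ℝ} (hr : -1 < r) (hc : 0 < c)
    (σ k : ℝ) :
    ∫ y : ℝ, |y| ^ r * ((1 + k * (y ^ 2 / σ ^ 2 - 1)) * exp (-(c * y ^ 2))) =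
      (1 - k + k / σ ^ 2 * ((r + 1) / 2 / c)) * ∫ y : ℝ, |y| ^ r * exp (-(c * y ^ 2)) := by
  have hr' : -1 < r + 2 := by linarith
  have h₂ : ∫ y : ℝ, |y| ^ (r + 2) * exp (-(c * y ^ 2)) =
      (r + 1) / 2 / c * ∫ y : ℝ, |y| ^ r * exp (-(c * y ^ 2)) := by
    rw [integral_abs_rpow_mul_exp_neg_mul_sq hr hc, integral_abs_rpow_mul_exp_neg_mul_sq hr' hc,
      show (r + 2 + 1) / 2 = (r + 1) / 2 + 1 by ring, Gamma_add_one (by linarith),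
      show -(r + 2 + 1) / 2 = -(r + 1) / 2 - 1 by ring, rpow_sub_one hc.ne']
    ring
  rw [add_mul, mul_assoc, ← h₂, ← integral_const_mul, ← integral_const_mul, ← integral_add
    ((integrable_abs_rpow_mul_exp_neg_mul_sq hr hc).const_mul _)
    ((integrable_abs_rpow_mul_exp_neg_mul_sq hr' hc).const_mul _)]
  congr 1 with y
  rw [← abs_rpow_mul_sq hr]
  ring

theorem integral_exp_neg_mul_sq_mul_quadratic_mul_exp {σ s : ℝ} (hσ : 0 < σ) (hs : 0 ≤ s)
    (k : ℝ) :
    ∫ y : ℝ, exp (-(s * y ^ 2)) * ((√(2 * π * σ ^ 2))⁻¹ *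
        ((1 + k * (y ^ 2 / σ ^ 2 - 1)) * exp (-((2 * σ ^ 2)⁻¹ * y ^ 2)))) =
      (√(1 + 2 * s * σ ^ 2))⁻¹ * (1 - k * (2 * s * σ ^ 2 / (1 + 2 * s * σ ^ 2))) := by
  have hT : 0 < 1 + 2 * s * σ ^ 2 := by positivity
  have hc : 0 < (1 + 2 * s * σ ^ 2) / (2 * σ ^ 2) := by positivity
  have h := integral_abs_rpow_mul_quadratic_mul_exp neg_one_lt_zero hc σ k
  simp only [rpow_zero, one_mul, ← neg_mul] at h
  rw [integral_gaussian] at h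
  have hpt : ∀ y : ℝ, exp (-(s * y ^ 2)) * ((√(2 * π * σ ^ 2))⁻¹ *
      ((1 + k * (y ^ 2 / σ ^ 2 - 1)) * exp (-((2 * σ ^ 2)⁻¹ * y ^ 2)))) =
      (√(2 * π * σ ^ 2))⁻¹ * ((1 + k * (y ^ 2 / σ ^ 2 - 1)) *
        exp (-((1 + 2 * s * σ ^ 2) / (2 * σ ^ 2)) * y ^ 2)) := by
    intro y
    rw [show -((1 + 2 * s * σ ^ 2) / (2 * σ ^ 2)) * y ^ 2 =
      -(s * y ^ 2) + -((2 * σ ^ 2)⁻¹ * y ^ 2) by field_simp; ring, exp_add]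
    ring
  simp only [hpt]
  rw [integral_const_mul, h,
    show π / ((1 + 2 * s * σ ^ 2) / (2 * σ ^ 2)) = 2 * π * σ ^ 2 / (1 + 2 * s * σ ^ 2) by
      field_simp, sqrt_div (by positivity)]
  have h₁ := sqrt_pos.2 hT
  have h₂ : 0 < √(2 * π * σ ^ 2) := sqrt_pos.2 (by positivity)
  generalize √(1 + 2 * s * σ ^ 2) = u at *
  generalize √(2 * π * σ ^ 2) = v at *
  field_simp
  ring

theorem integral_abs_rpow_mul_quadratic_mul_gaussian {σ b : ℝ} (hσ : 0 < σ) (hb : -1 < b)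
    (k : ℝ) :
    ∫ y : ℝ, |y| ^ b * ((√(2 * π * σ ^ 2))⁻¹ *
        ((1 + k * (y ^ 2 / σ ^ 2 - 1)) * exp (-((2 * σ ^ 2)⁻¹ * y ^ 2)))) =
      (1 + k * b) * E1 σ b := by
  have hc : 0 < (2 * σ ^ 2)⁻¹ := by positivity
  simp only [mul_left_comm (|_| ^ b) (√(2 * π * σ ^ 2))⁻¹, integral_const_mul]
  rw [integral_abs_rpow_mul_quadratic_mul_exp hb hc, mul_left_comm, ← integral_const_mul, E1]
  congr 1
  · field_simp
    ring
  · congr 1 with y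
    rw [show -y ^ 2 / (2 * σ ^ 2) = -((2 * σ ^ 2)⁻¹ * y ^ 2) by ring]
    ring

theorem E1_nonneg (σ a : ℝ) : 0 ≤ E1 σ a :=
  integral_nonneg fun x => by positivity

theorem integral_one_sub_exp_mul_abs_rpow_mul_gaussDensity2_le {σ₁ σ₂ ρ a s : ℝ}
    (hσ₁ : 0 < σ₁) (hσ₂ : 0 < σ₂) (hρ : ρ ^ 2 < 1) (ha : -1 < a) (ha₀ : a ≤ 0) (hs : 0 ≤ s) :
    ∫ q : ℝ × ℝ, (1 - exp (-(s * q.2 ^ 2))) * (|q.1| ^ a * gaussDensity2 σ₁ σ₂ ρ q.1 q.2) ≤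
      ∫ y : ℝ, (1 - exp (-(s * y ^ 2))) * (E1 σ₁ a * ((√(2 * π * σ₂ ^ 2))⁻¹ *
        ((1 + a / 2 * ρ ^ 2 * (y ^ 2 / σ₂ ^ 2 - 1)) * exp (-((2 * σ₂ ^ 2)⁻¹ * y ^ 2))))) := by
  have hi : ∀ t : ℝ, 0 ≤ t → Integrable fun y : ℝ => exp (-(t * y ^ 2)) *
      (E1 σ₁ a * ((√(2 * π * σ₂ ^ 2))⁻¹ *
        ((1 + a / 2 * ρ ^ 2 * (y ^ 2 / σ₂ ^ 2 - 1)) * exp (-((2 * σ₂ ^ 2)⁻¹ * y ^ 2))))) := by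
    intro t ht
    have h := ((integrable_abs_rpow_mul_quadratic_mul_exp neg_one_lt_zero
      (show 0 < t + (2 * σ₂ ^ 2)⁻¹ by positivity) σ₂ (a / 2 * ρ ^ 2)).const_mul
        (√(2 * π * σ₂ ^ 2))⁻¹).const_mul (E1 σ₁ a)
    refine h.congr (.of_forall fun y => ?_)
    simp only [rpow_zero, one_mul, add_mul, neg_add, exp_add]
    ring
  have hl₀ := integral_exp_neg_mul_sq_mul_abs_rpow_mul_gaussDensity2 hσ₁ hσ₂ hρ ha le_rfl
  have hl := integral_exp_neg_mul_sq_mul_abs_rpow_mul_gaussDensity2 hσ₁ hσ₂ hρ ha hs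
  have hr₀ := integral_exp_neg_mul_sq_mul_quadratic_mul_exp hσ₂ le_rfl (a / 2 * ρ ^ 2)
  have hr := integral_exp_neg_mul_sq_mul_quadratic_mul_exp hσ₂ hs (a / 2 * ρ ^ 2)
  have hli₀ := integrable_exp_neg_mul_sq_mul_abs_rpow_mul_gaussDensity2 hσ₁ hσ₂ hρ ha le_rfl
  have hli := integrable_exp_neg_mul_sq_mul_abs_rpow_mul_gaussDensity2 hσ₁ hσ₂ hρ ha hs
  have hri₀ := hi 0 le_rfl
  simp only [zero_mul, neg_zero, exp_zero, one_mul, mul_zero, add_zero, sqrt_one, inv_one,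
    div_one, one_rpow, sub_zero, mul_one] at hl₀ hr₀ hli₀ hri₀
  simp only [sub_mul, one_mul]
  rw [integral_sub hli₀ hli, integral_sub hri₀ (hi s hs), hl₀, hl]
  simp only [mul_left_comm (exp _) (E1 σ₁ a), integral_const_mul (E1 σ₁ a)]
  rw [hr₀, hr, mul_one, mul_assoc]
  refine sub_le_sub_left (mul_le_mul_of_nonneg_left ?_ (E1_nonneg _ _)) _
  gcongr
  have hT : 0 < 1 + 2 * s * σ₂ ^ 2 := by positivity
  have hP : 0 < (1 + 2 * s * σ₂ ^ 2 * (1 - ρ ^ 2)) / (1 + 2 * s * σ₂ ^ 2) := by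
    have : 0 < 1 - ρ ^ 2 := by linarith
    positivity
  have e : (1 + 2 * s * σ₂ ^ 2 * (1 - ρ ^ 2)) / (1 + 2 * s * σ₂ ^ 2) =
      1 + -(ρ ^ 2 * (2 * s * σ₂ ^ 2 / (1 + 2 * s * σ₂ ^ 2))) := by
    field_simp
    ring
  rw [e] at hP ⊢
  have h := one_add_mul_le_rpow_of_nonpos
    (show -1 < -(ρ ^ 2 * (2 * s * σ₂ ^ 2 / (1 + 2 * s * σ₂ ^ 2))) by linarith)
    (show a / 2 ≤ 0 by linarith)
  linarith

theorem E2_le {σ₁ σ₂ ρ a b : ℝ} (hσ₁ : 0 < σ₁) (hσ₂ : 0 < σ₂) (hρ : ρ ^ 2 < 1) (ha : -1 < a)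
    (ha₀ : a ≤ 0) (hb : 0 < b) (hb₂ : b ≤ 2) :
    E2 σ₁ σ₂ ρ a b ≤ E1 σ₁ a * ((1 + a / 2 * ρ ^ 2 * b) * E1 σ₂ b) := by
  have hpow : ∀ y : ℝ, (y ^ 2) ^ (b / 2) = |y| ^ b := fun y => by
    rw [← sq_abs, ← rpow_two, ← rpow_mul (abs_nonneg y)]
    congr 1
    ring
  have hm := measurable_gaussDensity2 σ₁ σ₂ ρ
  have hb' : -1 < b := by linarith
  have hI := integrable_abs_rpow_mul_abs_rpow_mul_gaussDensity2 hσ₁ hσ₂ hρ ha hb'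
  have hJ := ((integrable_abs_rpow_mul_quadratic_mul_exp hb'
    (show 0 < (2 * σ₂ ^ 2)⁻¹ by positivity) σ₂ (a / 2 * ρ ^ 2)).const_mul
      (√(2 * π * σ₂ ^ 2))⁻¹).const_mul (E1 σ₁ a)
  have h := integral_rpow_mul_le_of_integral_one_sub_exp_le
    (μ := (volume : Measure (ℝ × ℝ))) (ν := (volume : Measure ℝ)) (q := b / 2)
    (Z := fun q => q.2 ^ 2) (w := fun q => |q.1| ^ a * gaussDensity2 σ₁ σ₂ ρ q.1 q.2)
    (Z' := fun y => y ^ 2)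
    (w' := fun y => E1 σ₁ a * ((√(2 * π * σ₂ ^ 2))⁻¹ *
      ((1 + a / 2 * ρ ^ 2 * (y ^ 2 / σ₂ ^ 2 - 1)) * exp (-((2 * σ₂ ^ 2)⁻¹ * y ^ 2)))))
    (by linarith) (by linarith) (by fun_prop) (fun q => sq_nonneg _) (by fun_prop)
    (hI.congr (.of_forall fun q => by simp only [hpow]; ring))
    (by fun_prop) (fun y => sq_nonneg _) (by fun_prop)
    (hJ.congr (.of_forall fun y => by simp only [hpow]; ring))
    fun s hs =>
      integral_one_sub_exp_mul_abs_rpow_mul_gaussDensity2_le hσ₁ hσ₂ hρ ha ha₀ (le_of_lt hs)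
  simp only [hpow, mul_left_comm (|_| ^ b) (E1 σ₁ a), integral_const_mul] at h
  rw [integral_abs_rpow_mul_quadratic_mul_gaussian hσ₂ hb'] at h
  refine le_of_eq_of_le (integral_congr_ae (.of_forall fun q => ?_)) h
  ring

theorem opposite_gpi_quantitative_upper (σ₁ σ₂ ρ α₁ α₂ : ℝ)
    (hσ₁ : 0 < σ₁) (hσ₂ : 0 < σ₂) (hρ : ρ ∈ Set.Ioo (-1 : ℝ) 1)
    (hα₁ : α₁ ∈ Set.Ioo (-1 : ℝ) 0) (hα₂ : α₂ ∈ Set.Ioc (0 : ℝ) 2) :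
    E2 σ₁ σ₂ ρ α₁ α₂ - E1 σ₁ α₁ * E1 σ₂ α₂ ≤
      2 ^ ((α₁ + α₂) / 2) * α₁ * α₂ * σ₁ ^ α₁ * σ₂ ^ α₂ * ρ ^ 2 / (2 * π) *
        Real.Gamma ((α₁ + 1) / 2) * Real.Gamma ((α₂ + 1) / 2) ∧
    2 ^ ((α₁ + α₂) / 2) * α₁ * α₂ * σ₁ ^ α₁ * σ₂ ^ α₂ * ρ ^ 2 / (2 * π) *
        Real.Gamma ((α₁ + 1) / 2) * Real.Gamma ((α₂ + 1) / 2) ≤ 0 := by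
  obtain ⟨ha, ha₀⟩ := hα₁
  obtain ⟨hb, hb₂⟩ := hα₂
  have hρ' : ρ ^ 2 < 1 := (sq_lt_one_iff_abs_lt_one ρ).2 (abs_lt.2 hρ)
  have hpow : ∀ {σ : ℝ} (r : ℝ), 0 < σ → (2 * σ ^ 2) ^ (r / 2) = 2 ^ (r / 2) * σ ^ r := by
    intro σ r hσ
    rw [mul_rpow zero_le_two (by positivity), ← rpow_two, ← rpow_mul hσ.le]
    congr 2
    ring
  have hbound : 2 ^ ((α₁ + α₂) / 2) * α₁ * α₂ * σ₁ ^ α₁ * σ₂ ^ α₂ * ρ ^ 2 / (2 * π) *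
      Real.Gamma ((α₁ + 1) / 2) * Real.Gamma ((α₂ + 1) / 2) =
      α₁ * α₂ * ρ ^ 2 / 2 * (E1 σ₁ α₁ * E1 σ₂ α₂) := by
    rw [E1_eq hσ₁ ha, E1_eq hσ₂ (by linarith), hpow _ hσ₁, hpow _ hσ₂, add_div,
      rpow_add zero_lt_two]
    have h₄ := sqrt_pos.2 pi_pos
    have h₅ : √π ^ 2 = π := sq_sqrt pi_pos.le
    field_simp
    rw [h₅]
    ring
  have hM := mul_nonneg (E1_nonneg σ₁ α₁) (E1_nonneg σ₂ α₂)
  rw [hbound]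
  constructor
  · linarith [E2_le hσ₁ hσ₂ hρ' ha ha₀.le hb hb₂]
  · refine mul_nonpos_of_nonpos_of_nonneg ?_ hM
    have := mul_nonneg (mul_nonneg (neg_nonneg.2 ha₀.le) hb.le) (sq_nonneg ρ)
    linarith
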